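/- Let F = ℚ(q,a,b,c) be the field of rational functions over ℚ in the indeterminates q, a, b, c. For integers i ≥ j ≥ 0 define the Bressoud matrix entry 𝓑_{ij}(a,b) := (1 − a q^{2i}) (a;q)_{i+j} (a/b;q)_{i−j} b^{i−j} / ((1 − a)(bq;q)_{i+j}(q;q)_{i−j}), and set 𝓑_{ij}(a,b) := 0 for i < j. Then for all integers i ≥ j ≥ 0: Σ_{k=j}^{i} 𝓑_{ik}(a,b) 𝓑_{kj}(b,c) = 𝓑_{ij}(a,c). In particular, taking c = a, the matrix with entries 𝓑_{ij}(b,a) is inverse to the matrix with entries 𝓑_{ij}(a,b): Σ_{k=j}^{i} 𝓑_{ik}(a,b) 𝓑_{kj}(b,a) = δ_{ij}. -/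

import Mathlib

open Finset

/-- The `q`-shifted factorial `(a;q)_n = ∏_{i=0}^{n-1} (1 - a q^i)`. -/
noncomputable def qPoch {F : Type*} [Field F] (q a : F) (n : ℕ) : F :=
  ∏ i ∈ Finset.range n, (1 - a * q ^ i)

/-- The (gauge-transformed) Bressoud matrix entry `𝓑_{ij}(a,b)`, zero for `i < j`. -/
noncomputable def Bres {F : Type*} [Field F] (q a b : F) (i j : ℕ) : F :=
  if j ≤ i then
    (1 - a * q ^ (2 * i)) * qPoch q a (i + j) * qPoch q (a / b) (i - j) * b ^ (i - j) /
      ((1 - a) * qPoch q (b * q) (i + j) * qPoch q q (i - j))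
  else 0

/-- The field `F = ℚ(q,a,b,c)` of rational functions over `ℚ`. -/
noncomputable abbrev F9 : Type := FractionRing (MvPolynomial (Fin 4) ℚ)

section BressoudMatrix

variable {F : Type*} [Field F]

lemma qPoch_zero (q a : F) : qPoch q a 0 = 1 := by simp [qPoch]

lemma qPoch_succ (q a : F) (n : ℕ) :
    qPoch q a (n + 1) = qPoch q a n * (1 - a * q ^ n) := by
  simp [qPoch, Finset.prod_range_succ]

lemma qPoch_add (q a : F) (m n : ℕ) :
    qPoch q a (m + n) = qPoch q a m * qPoch q (a * q ^ m) n := by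
  simp [qPoch, Finset.prod_range_add, pow_add, mul_assoc]

lemma one_sub_mul_qPoch_mul (q a : F) (n : ℕ) :
    (1 - a) * qPoch q (a * q) n = qPoch q a n * (1 - a * q ^ n) := by
  have h := qPoch_add q a 1 n
  rw [add_comm, qPoch_succ] at h
  simpa [qPoch] using h.symm

lemma qPoch_ne_zero {q a : F} (h : ∀ k, a * q ^ k ≠ 1) (n : ℕ) : qPoch q a n ≠ 0 :=
  Finset.prod_ne_zero_iff.2 fun k _ => sub_ne_zero.2 (h k).symm

lemma mul_pow_mul_pow_ne_one {q a : F} (h : ∀ k, a * q ^ k ≠ 1) (m k : ℕ) :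
    a * q ^ m * q ^ k ≠ 1 := by
  rw [mul_assoc, ← pow_add]
  exact h _

lemma mul_mul_pow_ne_one {q a : F} (h : ∀ k, a * q ^ k ≠ 1) (k : ℕ) : a * q * q ^ k ≠ 1 := by
  simpa using mul_pow_mul_pow_ne_one h 1 k

lemma Bres_add_right {q a b : F} (hq₀ : q ≠ 0) (ha : ∀ k, a * q ^ k ≠ 1)
    (hb : ∀ k, b * q ^ k ≠ 1) (hq : ∀ k, q * q ^ k ≠ 1) {n m : ℕ} (hmn : m ≤ n) (j : ℕ) :
    Bres q a b (n + j) (m + j) * q ^ (2 * j * (n - m)) =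
      (1 - a * q ^ (2 * j)) * qPoch q a (2 * j) / ((1 - a) * qPoch q (b * q) (2 * j)) *
        Bres q (a * q ^ (2 * j)) (b * q ^ (2 * j)) n m := by
  obtain ⟨r, rfl⟩ := Nat.exists_eq_add_of_le hmn
  have h₁ : m + r + j + (m + j) = 2 * j + (m + r + m) := by ring
  have h₂ : m + r + j - (m + j) = r := by lia
  have ha₀ : 1 - a ≠ 0 := sub_ne_zero.2 (by simpa using (ha 0).symm)
  have ha₁ : 1 - a * q ^ (2 * j) ≠ 0 := sub_ne_zero.2 (ha _).symm
  have hb₁ := qPoch_ne_zero (mul_mul_pow_ne_one hb) (2 * j)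
  have hb₂ := qPoch_ne_zero (mul_mul_pow_ne_one (mul_pow_mul_pow_ne_one hb (2 * j))) (m + r + m)
  have hr := qPoch_ne_zero hq r
  have hdiv : a * q ^ (2 * j) / (b * q ^ (2 * j)) = a / b :=
    mul_div_mul_right _ _ (pow_ne_zero _ hq₀)
  simp only [Bres, h₁, h₂, qPoch_add q _ (2 * j), hdiv, Nat.add_sub_cancel_left,
    Nat.le_add_right, add_le_add_iff_right, if_true, mul_right_comm b q]
  field_simp
  ring

/-- The summand of the terminating very-well-poised `₆W₅` series, without its very-well-poised
factor and with independent lengths of the shifted factorials. -/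
noncomputable def wellPoisedTerm (q a b c : F) (N m r : ℕ) : F :=
  qPoch q a N * qPoch q (a / b) r * b ^ r * (qPoch q b m * qPoch q (b / c) m * c ^ m) /
    (qPoch q (b * q) N * qPoch q q r * (qPoch q (c * q) m * qPoch q q m))

section Recurrences

variable {q a b c : F}

lemma wellPoisedTerm_succ_left (N m r : ℕ) :
    wellPoisedTerm q a b c (N + 1) m r =
      wellPoisedTerm q a b c N m r * ((1 - a * q ^ N) / (1 - b * q * q ^ N)) := by
  simp only [wellPoisedTerm, qPoch_succ, div_mul_div_comm]
  congr 1 <;> ring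

lemma wellPoisedTerm_succ_right (hb₀ : b ≠ 0) (N m r : ℕ) :
    wellPoisedTerm q a b c N m (r + 1) =
      wellPoisedTerm q a b c N m r * ((b - a * q ^ r) / (1 - q * q ^ r)) := by
  have h : b - a * q ^ r = b * (1 - a / b * q ^ r) := by field_simp
  simp only [wellPoisedTerm, qPoch_succ, div_mul_div_comm, h]
  congr 1 <;> ring

lemma wellPoisedTerm_succ_mid (hc₀ : c ≠ 0) (N m r : ℕ) :
    wellPoisedTerm q a b c N (m + 1) r =
      wellPoisedTerm q a b c N m r *
        ((1 - b * q ^ m) * (c - b * q ^ m) / ((1 - c * q * q ^ m) * (1 - q * q ^ m))) := by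
  have h : c - b * q ^ m = c * (1 - b / c * q ^ m) := by field_simp
  simp only [wellPoisedTerm, qPoch_succ, div_mul_div_comm, h]
  congr 1 <;> ring

/-- Wilf–Zeilberger telescoping of the well-poised summand. -/
lemma sum_range_wellPoisedTerm (hq : ∀ k, q * q ^ k ≠ 1) (hb₀ : b ≠ 0) (hc₀ : c ≠ 0)
    (hb : ∀ k, b * q ^ k ≠ 1) (hc : ∀ k, c * q ^ k ≠ 1) (n p : ℕ) (hp : p ≤ n + 1) :
    ∑ m ∈ range p, (1 - b * q ^ (2 * m)) *
      ((1 - c * q * q ^ n) * (1 - q * q ^ n) *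
          wellPoisedTerm q a b c (n + 1 + m) m (n + 1 - m) -
        (1 - a * q ^ n) * (c - a * q ^ n) * wellPoisedTerm q a b c (n + m) m (n - m)) =
    -(1 - a * q * q ^ (2 * n)) * (1 - q ^ p) * (1 - c * q ^ p) *
      wellPoisedTerm q a b c (n + p) p (n + 1 - p) := by
  induction p with
  | zero => simp
  | succ m ih =>
    rw [sum_range_succ, ih (by lia)]
    obtain ⟨r, rfl⟩ := Nat.exists_eq_add_of_le (Nat.le_of_succ_le_succ hp)
    have e₁ : m + r + 1 - m = r + 1 := by lia
    have e₂ : m + r + 1 - (m + 1) = r := by lia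
    have e₃ : m + r - m = r := by lia
    have e₄ : m + r + 1 + m = m + r + m + 1 := by ring
    rw [e₁, e₂, e₃, e₄, ← add_assoc, wellPoisedTerm_succ_right hb₀, wellPoisedTerm_succ_mid hc₀,
      wellPoisedTerm_succ_right hb₀, wellPoisedTerm_succ_left]
    have h₁ : 1 - b * q * q ^ (m + r + m) ≠ 0 := sub_ne_zero.2 (mul_mul_pow_ne_one hb _).symm
    have h₂ : 1 - q * q ^ r ≠ 0 := sub_ne_zero.2 (hq r).symm
    have h₃ : 1 - q * q ^ m ≠ 0 := sub_ne_zero.2 (hq m).symm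
    have h₄ : 1 - c * q * q ^ m ≠ 0 := sub_ne_zero.2 (mul_mul_pow_ne_one hc _).symm
    generalize wellPoisedTerm q a b c (m + r + m) m r = U
    generalize hD₁ : 1 - b * q * q ^ (m + r + m) = D₁ at *
    generalize hD₂ : 1 - q * q ^ r = D₂ at *
    generalize hD₃ : 1 - q * q ^ m = D₃ at *
    generalize hD₄ : 1 - c * q * q ^ m = D₄ at *
    field_simp
    subst hD₁ hD₂ hD₃ hD₄
    ring

/-- The terminating very-well-poised `₆W₅` summation. -/
lemma sum_wellPoisedTerm (hq : ∀ k, q * q ^ k ≠ 1) (hb₀ : b ≠ 0) (hc₀ : c ≠ 0)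
    (hb : ∀ k, b * q ^ k ≠ 1) (hc : ∀ k, c * q ^ k ≠ 1) (n : ℕ) :
    ∑ m ∈ range (n + 1), (1 - b * q ^ (2 * m)) * wellPoisedTerm q a b c (n + m) m (n - m) =
      (1 - b) * (qPoch q a n * qPoch q (a / c) n * c ^ n /
        (qPoch q (c * q) n * qPoch q q n)) := by
  induction n with
  | zero => simp [wellPoisedTerm, qPoch_zero]
  | succ n ih =>
    have hsum := sum_range_wellPoisedTerm (a := a) hq hb₀ hc₀ hb hc n (n + 1) le_rfl
    have h₁ : 1 - b * q * q ^ (2 * n + 1) ≠ 0 := sub_ne_zero.2 (mul_mul_pow_ne_one hb _).symm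
    have h₂ : 1 - q * q ^ n ≠ 0 := sub_ne_zero.2 (hq n).symm
    have h₃ : 1 - c * q * q ^ n ≠ 0 := sub_ne_zero.2 (mul_mul_pow_ne_one hc _).symm
    have hlast : (1 - b * q ^ (2 * (n + 1))) *
        wellPoisedTerm q a b c (n + 1 + (n + 1)) (n + 1) (n + 1 - (n + 1)) =
        (1 - a * q * q ^ (2 * n)) *
          wellPoisedTerm q a b c (n + (n + 1)) (n + 1) (n + 1 - (n + 1)) := by
      have e : n + 1 + (n + 1) = n + (n + 1) + 1 := by ring
      have e' : n + (n + 1) = 2 * n + 1 := by ring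
      have hpow : b * q ^ (2 * (n + 1)) = b * q * q ^ (2 * n + 1) := by ring
      have hpow' : a * q ^ (2 * n + 1) = a * q * q ^ (2 * n) := by ring
      rw [e, wellPoisedTerm_succ_left, e', hpow, hpow', mul_left_comm, mul_div_cancel₀ _ h₁,
        mul_comm]
    have hrec : (1 - c * q * q ^ n) * (1 - q * q ^ n) *
        (qPoch q a (n + 1) * qPoch q (a / c) (n + 1) * c ^ (n + 1) /
          (qPoch q (c * q) (n + 1) * qPoch q q (n + 1))) =
        (1 - a * q ^ n) * (c - a * q ^ n) *
          (qPoch q a n * qPoch q (a / c) n * c ^ n / (qPoch q (c * q) n * qPoch q q n)) := by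
      have hc' : c - a * q ^ n = c * (1 - a / c * q ^ n) := by field_simp
      have h₄ := qPoch_ne_zero hq n
      have h₅ := qPoch_ne_zero (mul_mul_pow_ne_one hc) n
      rw [hc']
      simp only [qPoch_succ]
      generalize 1 - a / c * q ^ n = A
      field_simp
      ring
    simp only [mul_sub, mul_left_comm (1 - b * q ^ _), sum_sub_distrib, ← mul_sum] at hsum
    rw [ih] at hsum
    rw [sum_range_succ, hlast]
    apply mul_left_cancel₀ (mul_ne_zero h₃ h₂)
    linear_combination hsum - (1 - b) * hrec

end Recurrences

lemma Bres_mul_Bres_zero (q a b c : F) {n m : ℕ} (hmn : m ≤ n) :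
    Bres q a b n m * Bres q b c m 0 =
      (1 - a * q ^ (2 * n)) / ((1 - a) * (1 - b)) *
        ((1 - b * q ^ (2 * m)) * wellPoisedTerm q a b c (n + m) m (n - m)) := by
  simp only [Bres, wellPoisedTerm, hmn, zero_le, if_true, add_zero, Nat.sub_zero]
  rw [div_mul_div_comm, mul_div_assoc', div_mul_div_comm]
  congr 1 <;> ring

lemma sum_Bres_mul_Bres_zero {q a b c : F} (hb₀ : b ≠ 0) (hc₀ : c ≠ 0)
    (hq : ∀ k, q * q ^ k ≠ 1) (hb : ∀ k, b * q ^ k ≠ 1) (hc : ∀ k, c * q ^ k ≠ 1) (n : ℕ) :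
    ∑ m ∈ range (n + 1), Bres q a b n m * Bres q b c m 0 = Bres q a c n 0 := by
  have hb₁ : 1 - b ≠ 0 := sub_ne_zero.2 (by simpa using (hb 0).symm)
  rw [sum_congr rfl fun m hm => Bres_mul_Bres_zero q a b c (Nat.le_of_lt_succ (mem_range.1 hm)),
    ← mul_sum, sum_wellPoisedTerm hq hb₀ hc₀ hb hc]
  simp only [Bres, zero_le, if_true, add_zero, Nat.sub_zero]
  rw [← div_div, ← mul_assoc, div_mul_cancel₀ _ hb₁, div_mul_div_comm]
  congr 1 <;> ring

/-- Transition property of the Bressoud matrices for generic parameters. -/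
theorem sum_Bres_mul_Bres {q a b c : F} (hq₀ : q ≠ 0) (hb₀ : b ≠ 0) (hc₀ : c ≠ 0)
    (hq : ∀ k, q * q ^ k ≠ 1) (ha : ∀ k, a * q ^ k ≠ 1) (hb : ∀ k, b * q ^ k ≠ 1)
    (hc : ∀ k, c * q ^ k ≠ 1) {i j : ℕ} (hij : j ≤ i) :
    ∑ k ∈ Icc j i, Bres q a b i k * Bres q b c k j = Bres q a c i j := by
  obtain ⟨n, rfl⟩ := Nat.exists_eq_add_of_le' hij
  have hb₁ : 1 - b ≠ 0 := sub_ne_zero.2 (by simpa using (hb 0).symm)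
  have hbq := qPoch_ne_zero (mul_mul_pow_ne_one hb) (2 * j)
  have hbj := one_sub_mul_qPoch_mul q b (2 * j)
  have hshift := sum_Bres_mul_Bres_zero (a := a * q ^ (2 * j))
    (mul_ne_zero hb₀ (pow_ne_zero (2 * j) hq₀)) (mul_ne_zero hc₀ (pow_ne_zero (2 * j) hq₀))
    hq (mul_pow_mul_pow_ne_one hb _) (mul_pow_mul_pow_ne_one hc _) n
  have hac := Bres_add_right hq₀ ha hc hq (Nat.zero_le n) j
  apply mul_right_cancel₀ (pow_ne_zero (2 * j * n) hq₀)
  rw [zero_add, Nat.sub_zero] at hac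
  rw [hac, ← hshift, mul_sum, sum_mul, ← Ico_add_one_right_eq_Icc, sum_Ico_eq_sum_range,
    show n + j + 1 - j = n + 1 by lia]
  refine sum_congr rfl fun m hm => ?_
  have hmn := Nat.le_of_lt_succ (mem_range.1 hm)
  have hab := Bres_add_right hq₀ ha hb hq hmn j
  have hbc := Bres_add_right hq₀ hb hc hq (Nat.zero_le m) j
  rw [zero_add, Nat.sub_zero] at hbc
  have hpow : q ^ (2 * j * n) = q ^ (2 * j * (n - m)) * q ^ (2 * j * m) := by
    rw [← pow_add, ← mul_add, Nat.sub_add_cancel hmn]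
  rw [hpow, add_comm j m, mul_mul_mul_comm, hab, hbc, mul_mul_mul_comm, div_mul_div_comm,
    mul_comm (1 - b * _), ← hbj]
  congr 1
  field_simp

lemma Bres_self {q a : F} (ha₀ : a ≠ 0) (ha : ∀ k, a * q ^ k ≠ 1)
    {i j : ℕ} (hij : j ≤ i) : Bres q a a i j = if i = j then 1 else 0 := by
  split_ifs with h
  · subst h
    have ha₁ : 1 - a ≠ 0 := sub_ne_zero.2 (by simpa using (ha 0).symm)
    have h₁ := one_sub_mul_qPoch_mul q a (2 * i)
    have h₂ := qPoch_ne_zero (mul_mul_pow_ne_one ha) (2 * i)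
    simp only [Bres, le_refl, if_true, Nat.sub_self, qPoch_zero, ← two_mul]
    rw [← mul_comm (qPoch q a _), ← h₁]
    simp [ha₁, h₂]
  · obtain ⟨r, rfl⟩ := Nat.exists_eq_add_of_lt (lt_of_le_of_ne hij (Ne.symm h))
    have : qPoch q (a / a) (j + r + 1 - j) = 0 :=
      prod_eq_zero (i := 0) (by simp) (by simp [ha₀])
    simp [Bres, this]

end BressoudMatrix

lemma MvPolynomial.algebraMap_X_mul_pow_ne_one {σ R : Type*} [CommRing R] [IsDomain R]
    (s t : σ) (k : ℕ) :
    algebraMap (MvPolynomial σ R) (FractionRing (MvPolynomial σ R)) (X s) *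
      algebraMap (MvPolynomial σ R) (FractionRing (MvPolynomial σ R)) (X t) ^ k ≠ 1 := by
  rw [← map_pow, ← map_mul, ← map_one (algebraMap (MvPolynomial σ R) _)]
  intro h
  simpa using congrArg constantCoeff (IsFractionRing.injective _ _ h)

/-- Proposition D.3, after Agarwal–Andrews–Bressoud: the transition property
`Σ_{k=j}^{i} 𝓑_{ik}(a,b) 𝓑_{kj}(b,c) = 𝓑_{ij}(a,c)`; in particular (`c = a`)
Bressoud's matrix inversion `Σ_{k=j}^{i} 𝓑_{ik}(a,b) 𝓑_{kj}(b,a) = δ_{ij}`. -/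
theorem statement9
    (q a b c : F9)
    (hq : q = algebraMap (MvPolynomial (Fin 4) ℚ) F9 (MvPolynomial.X 0))
    (ha : a = algebraMap (MvPolynomial (Fin 4) ℚ) F9 (MvPolynomial.X 1))
    (hb : b = algebraMap (MvPolynomial (Fin 4) ℚ) F9 (MvPolynomial.X 2))
    (hc : c = algebraMap (MvPolynomial (Fin 4) ℚ) F9 (MvPolynomial.X 3)) :
    ∀ i j : ℕ, j ≤ i →
      (∑ k ∈ Finset.Icc j i, Bres q a b i k * Bres q b c k j = Bres q a c i j) ∧
      (∑ k ∈ Finset.Icc j i, Bres q a b i k * Bres q b a k j =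
        if i = j then 1 else 0) := by
  have hgen := MvPolynomial.algebraMap_X_mul_pow_ne_one (σ := Fin 4) (R := ℚ)
  have hne (s : Fin 4) : algebraMap (MvPolynomial (Fin 4) ℚ) F9 (MvPolynomial.X s) ≠ 0 := by
    simp [MvPolynomial.X_ne_zero]
  subst hq ha hb hc
  intro i j hij
  refine ⟨sum_Bres_mul_Bres (hne _) (hne _) (hne _) (hgen _ _) (hgen _ _) (hgen _ _) (hgen _ _) hij,
    ?_⟩
  rw [sum_Bres_mul_Bres (hne _) (hne _) (hne _) (hgen _ _) (hgen _ _) (hgen _ _) (hgen _ _) hij,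
    Bres_self (hne _) (hgen _ _) hij]
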